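/- For every n ≥ 1, the polynomial R_n, regarded as a polynomial over ℂ, has exactly n distinct roots (so all roots are simple); every root is purely imaginary (has real part zero); and the set of roots is invariant under negation. Moreover, for n ≥ 2 the roots of R_{n−1} interlace those of R_n: writing the roots of R_n as iβ with β real, exactly one root of R_{n−1} lies in each open interval between consecutive values of β. -/

import Mathlib

/-- `R_n(ζ) = Σ_{k=0}^{⌊n/2⌋} (n!/((n−2k)!·k!·(k+1)!))·ζ^{n−2k}` in `ℚ[ζ]`. -/
noncomputable def R (n : ℕ) : Polynomial ℚ :=
  ∑ k ∈ Finset.range (n / 2 + 1),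
    Polynomial.C ((n.factorial : ℚ) /
      ((Nat.factorial (n - 2 * k) * Nat.factorial k * Nat.factorial (k + 1) : ℕ) : ℚ)) *
      Polynomial.X ^ (n - 2 * k)

/-- `R n` regarded as a polynomial over `ℂ`. -/
noncomputable def Rc (n : ℕ) : Polynomial ℂ := (R n).map (algebraMap ℚ ℂ)

open Polynomial

/-- real companion polynomial: `R_n(iβ) = i^n P_n(β)` -/
noncomputable def PR (n : ℕ) : Polynomial ℝ :=
  ∑ k ∈ Finset.range (n / 2 + 1),
    Polynomial.C ((-1) ^ k * ((n.factorial : ℝ) /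
      ((Nat.factorial (n - 2 * k) * Nat.factorial k * Nat.factorial (k + 1) : ℕ) : ℝ))) *
      Polynomial.X ^ (n - 2 * k)

lemma PR_coeff (j k : ℕ) : (PR (j + 2 * k)).coeff j =
    (-1) ^ k * (((j + 2 * k).factorial : ℝ) / (j.factorial * k.factorial * (k + 1).factorial)) := by
  unfold PR
  rw [finsetSum_coeff, Finset.sum_eq_single k]
  · rw [coeff_C_mul_X_pow, if_pos (by omega)]
    have : j + 2 * k - 2 * k = j := by omega
    rw [this]; push_cast; rfl
  · intro b hb hbk
    rw [Finset.mem_range] at hb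
    rw [coeff_C_mul_X_pow, if_neg (by omega)]
  · intro h
    exact absurd (Finset.mem_range.2 (by omega)) h

lemma PR_coeff_zero (n j : ℕ) (h : ∀ k, n ≠ j + 2 * k) : (PR n).coeff j = 0 := by
  unfold PR
  rw [finsetSum_coeff]
  apply Finset.sum_eq_zero
  intro b hb
  rw [Finset.mem_range] at hb
  rw [coeff_C_mul_X_pow, if_neg]
  intro hj
  exact h b (by omega)

lemma PR_coeff' (n j k : ℕ) (h : n = j + 2 * k) : (PR n).coeff j =
    (-1) ^ k * ((n.factorial : ℝ) / (j.factorial * k.factorial * (k + 1).factorial)) := by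
  subst h; exact PR_coeff j k

lemma PR_deriv (n : ℕ) : derivative (PR (n + 1)) = C ((n : ℝ) + 1) * PR n := by
  ext j
  rw [coeff_derivative, coeff_C_mul]
  by_cases h : ∃ k, n = j + 2 * k
  · obtain ⟨k, hk⟩ := h
    rw [PR_coeff' (n + 1) (j + 1) k (by omega), PR_coeff' n j k hk,
      Nat.factorial_succ n, Nat.factorial_succ j]
    push_cast
    have := Nat.factorial_ne_zero j
    have := Nat.factorial_ne_zero k
    have := Nat.factorial_ne_zero (k + 1)
    field_simp
  · push Not at h
    rw [PR_coeff_zero n j h, PR_coeff_zero (n + 1) (j + 1) (fun k hk => h k (by omega))]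
    simp

lemma PR_rec (n : ℕ) : C ((n : ℝ) + 3) * PR (n + 1) =
    C (2 * (n : ℝ) + 3) * (X * PR n) - (X * (X * derivative (PR n)) + C 4 * derivative (PR n)) := by
  ext j
  simp only [coeff_sub, coeff_add, coeff_C_mul]
  rcases j with _ | j
  · simp only [mul_coeff_zero, coeff_X_zero, zero_mul, mul_zero, coeff_derivative]
    by_cases h : ∃ k, n = 1 + 2 * k
    · obtain ⟨k, hk⟩ := h
      rw [PR_coeff' (n + 1) 0 (k + 1) (by omega), PR_coeff' n (0 + 1) k (by omega),
        Nat.factorial_succ n, Nat.factorial_succ (k + 1), Nat.factorial_succ k]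
      have := Nat.factorial_ne_zero k
      simp [hk, pow_succ]
      field_simp
      ring
    · push Not at h
      rw [PR_coeff_zero n (0 + 1) (fun k hk => h k (by omega)),
        PR_coeff_zero (n + 1) 0 (fun k hk => h (k - 1) (by omega))]
      simp
  · have e : (X * derivative (PR n)).coeff j = j * (PR n).coeff j := by
      rcases j with _ | j
      · simp
      · rw [coeff_X_mul, coeff_derivative]; push_cast; ring
    rw [coeff_X_mul, coeff_X_mul, e, coeff_derivative]
    by_cases h : ∃ k, n = j + 2 * k
    · obtain ⟨k, hk⟩ := h
      rw [PR_coeff' (n + 1) (j + 1) k (by omega), PR_coeff' n j k hk]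
      have := Nat.factorial_ne_zero j
      rcases k with _ | k
      · rw [PR_coeff_zero n (j + 1 + 1) (fun k hk => by omega), Nat.factorial_succ n,
          Nat.factorial_succ j]
        simp at hk
        subst hk
        simp
        field_simp
        ring
      · rw [PR_coeff' n (j + 1 + 1) k (by omega), Nat.factorial_succ n,
          Nat.factorial_succ (j + 1), Nat.factorial_succ j, Nat.factorial_succ (k + 1),
          Nat.factorial_succ k]
        have := Nat.factorial_ne_zero k
        have := Nat.factorial_ne_zero n
        have hk' : (n : ℝ) = j + 2 * (k + 1) := by exact_mod_cast hk
        push_cast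
        rw [pow_succ]
        field_simp
        rw [hk']
        ring
    · push Not at h
      rw [PR_coeff_zero n j h, PR_coeff_zero (n + 1) (j + 1) (fun k hk => h k (by omega)),
        PR_coeff_zero n (j + 1 + 1) (fun k hk => h (k + 1) (by omega))]
      simp

lemma PR_zero : PR 0 = 1 := by simp [PR]

lemma PR_rec_eval (n : ℕ) (x : ℝ) : ((n : ℝ) + 3) * (PR (n + 1)).eval x =
    (2 * (n : ℝ) + 3) * x * (PR n).eval x - (x ^ 2 + 4) * (derivative (PR n)).eval x := by
  have := congrArg (eval x) (PR_rec n)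
  simp only [eval_mul, eval_C, eval_sub, eval_add, eval_X] at this
  rw [this]; ring

lemma PR_coprime (n : ℕ) (x : ℝ) : ¬ ((PR (n + 1)).eval x = 0 ∧ (PR n).eval x = 0) := by
  induction n with
  | zero => simp [PR_zero]
  | succ n ih =>
    rintro ⟨h1, h2⟩
    apply ih
    refine ⟨h2, ?_⟩
    have := PR_rec_eval (n + 1) x
    rw [h1, h2, PR_deriv, eval_mul, eval_C] at this
    have h3 : (x ^ 2 + 4) * ((n : ℝ) + 1) * (PR n).eval x = 0 := by linarith
    rcases mul_eq_zero.1 h3 with h | h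
    · have : (x ^ 2 + 4) * ((n : ℝ) + 1) > 0 := by positivity
      linarith
    · exact h

lemma PR_simple (n : ℕ) (x : ℝ) (h : (PR n).eval x = 0) : (derivative (PR n)).eval x ≠ 0 := by
  rcases n with _ | n
  · simp [PR_zero] at h
  · intro h'
    rw [PR_deriv, eval_mul, eval_C] at h'
    refine PR_coprime n x ⟨h, ?_⟩
    rcases mul_eq_zero.1 h' with h | h
    · have : (n : ℝ) + 1 > 0 := by positivity
      linarith
    · exact h

lemma PR_natDegree_le (n : ℕ) : (PR n).natDegree ≤ n :=
  natDegree_le_iff_coeff_eq_zero.2 fun N hN => PR_coeff_zero n N (fun k hk => by omega)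

lemma PR_coeff_self (n : ℕ) : (PR n).coeff n = 1 := by
  rw [PR_coeff' n n 0 (by omega)]
  have := Nat.factorial_ne_zero n
  simp [this]

lemma PR_natDegree (n : ℕ) : (PR n).natDegree = n :=
  le_antisymm (PR_natDegree_le n) (le_natDegree_of_ne_zero (by rw [PR_coeff_self]; exact one_ne_zero))

lemma PR_ne_zero (n : ℕ) : PR n ≠ 0 := by
  intro h
  have := PR_coeff_self n
  simp [h] at this

lemma PR_neg (n : ℕ) (x : ℝ) : (PR n).eval (-x) = (-1) ^ n * (PR n).eval x := by
  unfold PR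
  simp only [eval_finsetSum, eval_mul, eval_C, eval_pow, eval_X]
  rw [Finset.mul_sum]
  refine Finset.sum_congr rfl fun k hk => ?_
  rw [Finset.mem_range] at hk
  have e : ((-1 : ℝ)) ^ n = (-1) ^ (n - 2 * k) := by
    conv_lhs => rw [show n = n - 2 * k + 2 * k by omega]
    rw [pow_add, pow_mul (-1 : ℝ) 2 k]; simp
  rw [neg_pow, e]; ring

lemma PR_neg_root (n : ℕ) (x : ℝ) (h : (PR n).eval x = 0) : (PR n).eval (-x) = 0 := by
  rw [PR_neg, h, mul_zero]

lemma Rc_eval (n : ℕ) (x : ℝ) :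
    (Rc n).eval (Complex.I * (x : ℂ)) = Complex.I ^ n * (((PR n).eval x : ℝ) : ℂ) := by
  unfold Rc R PR
  simp only [Polynomial.map_sum, Polynomial.map_mul, Polynomial.map_pow, map_C, map_X,
    eval_finsetSum, eval_mul, eval_C, eval_pow, eval_X]
  rw [Complex.ofReal_sum, Finset.mul_sum]
  refine Finset.sum_congr rfl fun k hk => ?_
  rw [Finset.mem_range] at hk
  have e : Complex.I ^ n = Complex.I ^ (n - 2 * k) * (-1) ^ k := by
    conv_lhs => rw [show n = n - 2 * k + 2 * k by omega]
    rw [pow_add, pow_mul Complex.I 2 k, Complex.I_sq]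
  have e2 : ((-1 : ℂ)) ^ k * (-1) ^ k = 1 := by rw [← mul_pow]; simp
  rw [e]
  push_cast
  rw [mul_pow]
  linear_combination (- (n.factorial : ℂ) / ((n - 2 * k).factorial * k.factorial * (k + 1).factorial)
    * Complex.I ^ (n - 2 * k) * x ^ (n - 2 * k)) * e2

lemma Rc_root_iff (n : ℕ) (x : ℝ) :
    (Rc n).IsRoot (Complex.I * (x : ℂ)) ↔ (PR n).eval x = 0 := by
  rw [IsRoot, Rc_eval]
  simp

lemma PR_rolle_up (n : ℕ) (a b : ℝ) (hab : a < b) (ha : (PR n).eval a = 0)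
    (hb : (PR n).eval b = 0) : ∃ c ∈ Set.Ioo a b, (PR (n + 1)).eval c = 0 := by
  set s : ℝ := -((n : ℝ) + 3 / 2) with hs
  have hd : ∀ x : ℝ, HasDerivAt (fun x => (x ^ 2 + 4) ^ s * (PR n).eval x)
      ((2 * x * s * (x ^ 2 + 4) ^ (s - 1)) * (PR n).eval x
        + (x ^ 2 + 4) ^ s * (derivative (PR n)).eval x) x := by
    intro x
    have h1 : HasDerivAt (fun x : ℝ => x ^ 2 + 4) (2 * x) x := by
      simpa using (hasDerivAt_pow 2 x).add_const (4 : ℝ)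
    exact (h1.rpow_const (Or.inl (by positivity))).mul ((PR n).hasDerivAt x)
  obtain ⟨c, hc, h⟩ := exists_hasDerivAt_eq_zero hab
    (fun x _ => (hd x).continuousAt.continuousWithinAt) (by simp [ha, hb]) (fun x _ => hd x)
  refine ⟨c, hc, ?_⟩
  have hp : (0 : ℝ) < c ^ 2 + 4 := by positivity
  have e : (c ^ 2 + 4) ^ s = (c ^ 2 + 4) ^ (s - 1) * (c ^ 2 + 4) := by
    rw [Real.rpow_sub_one hp.ne']; field_simp
  rw [e] at h
  have hq : (0 : ℝ) < (c ^ 2 + 4) ^ (s - 1) := Real.rpow_pos_of_pos hp _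
  have r := PR_rec_eval n c
  have : (c ^ 2 + 4) ^ (s - 1) * (((n : ℝ) + 3) * (PR (n + 1)).eval c) = 0 := by
    rw [r]
    have : 2 * (n : ℝ) + 3 = -2 * s := by rw [hs]; ring
    rw [this]; linarith
  have hn : (0 : ℝ) < (n : ℝ) + 3 := by positivity
  simpa [hq.ne', hn.ne'] using this

lemma PR_rolle_down (n : ℕ) (a b : ℝ) (hab : a < b) (ha : (PR (n + 1)).eval a = 0)
    (hb : (PR (n + 1)).eval b = 0) : ∃ c ∈ Set.Ioo a b, (PR n).eval c = 0 := by
  obtain ⟨c, hc, h⟩ := exists_hasDerivAt_eq_zero hab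
    (PR (n + 1)).continuousOn (by simp [ha, hb]) (fun x _ => (PR (n + 1)).hasDerivAt x)
  refine ⟨c, hc, ?_⟩
  rw [PR_deriv, eval_mul, eval_C] at h
  have hn : (0 : ℝ) < (n : ℝ) + 1 := by positivity
  simpa [hn.ne'] using h

lemma PR_tendsto (n : ℕ) (hn : 1 ≤ n) :
    Filter.Tendsto (fun x => (PR n).eval x) Filter.atTop Filter.atTop := by
  apply Polynomial.tendsto_atTop_of_leadingCoeff_nonneg
  · rw [← natDegree_pos_iff_degree_pos, PR_natDegree]; omega
  · rw [leadingCoeff, PR_natDegree, PR_coeff_self]; exact zero_le_one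

/-- beyond a point with negative value there is a root -/
lemma PR_root_above (n : ℕ) (hn : 1 ≤ n) (m : ℝ) (h : (PR n).eval m < 0) :
    ∃ b, m < b ∧ (PR n).eval b = 0 := by
  obtain ⟨M, hM, hmM⟩ := (((PR_tendsto n hn).eventually_gt_atTop 0).and
    (Filter.eventually_gt_atTop m)).exists
  obtain ⟨c, hc, h0⟩ := intermediate_value_Ioo hmM.le (PR n).continuousOn ⟨h, hM⟩
  exact ⟨c, hc.1, h0⟩

lemma PR_top_root (n : ℕ) (m : ℝ) (h : (PR n).eval m = 0)
    (hmax : ∀ x, (PR n).eval x = 0 → x ≤ m) : ∃ b, m < b ∧ (PR (n + 1)).eval b = 0 := by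
  apply PR_root_above _ (by omega)
  have hn : 1 ≤ n := by
    rcases n with _ | n
    · simp [PR_zero] at h
    · omega
  have hpos : ∀ x, m < x → 0 ≤ (PR n).eval x := by
    intro x hx
    by_contra hneg
    push Not at hneg
    obtain ⟨b, hb, hb0⟩ := PR_root_above n hn x hneg
    linarith [hmax b hb0]
  have hd : 0 ≤ (derivative (PR n)).eval m := by
    have h1 := ((PR n).hasDerivAt m).hasDerivWithinAt (s := Set.Ioi m)
    rw [hasDerivWithinAt_iff_tendsto_slope' (by simp)] at h1
    refine ge_of_tendsto h1 ?_
    filter_upwards [self_mem_nhdsWithin] with x hx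
    rw [slope_def_field, h]
    have : m < x := hx
    exact div_nonneg (by linarith [hpos x hx]) (by linarith)
  have hd' : 0 < (derivative (PR n)).eval m := lt_of_le_of_ne hd (PR_simple n m h).symm
  have r := PR_rec_eval n m
  rw [h] at r
  have : 0 < (m ^ 2 + 4) * (derivative (PR n)).eval m := by positivity
  have hn' : (0 : ℝ) < (n : ℝ) + 3 := by positivity
  by_contra hc
  push Not at hc
  nlinarith [mul_nonneg hn'.le hc]

lemma mem_PR (n : ℕ) (x : ℝ) : x ∈ (PR n).roots.toFinset ↔ (PR n).eval x = 0 := by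
  simp [PR_ne_zero]

lemma PR_card (n : ℕ) : n ≤ (PR n).roots.toFinset.card := by
  induction n with
  | zero => simp
  | succ n ih =>
    rcases Nat.eq_zero_or_pos n with h0 | h0
    · subst h0
      refine Finset.card_pos.2 ⟨0, (mem_PR _ _).2 ?_⟩
      have := PR_neg (0 + 1) 0
      simp at this
      simp
      linarith
    · set S := (PR n).roots.toFinset with hS
      have hne : S.Nonempty := Finset.card_pos.1 (by omega)
      set m := S.max' hne
      have hm0 : (PR n).eval m = 0 := (mem_PR _ _).1 (S.max'_mem hne)
      have hmax : ∀ x, (PR n).eval x = 0 → x ≤ m := fun x hx => S.le_max' x ((mem_PR _ _).2 hx)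
      have hmin : ∀ x, (PR n).eval x = 0 → -m ≤ x := fun x hx => by
        linarith [hmax _ (PR_neg_root n x hx)]
      obtain ⟨b, hb, hb0⟩ := PR_top_root n m hm0 hmax
      have hm : 0 ≤ m := by linarith [hmin m hm0]
      have hcard : S.card ≤ (((PR (n + 1)).roots.toFinset.erase b).erase (-b)).card + 1 := by
        apply Finset.card_le_of_interleaved
        intro x hx y hy hxy _
        rw [hS, mem_PR] at hx hy
        obtain ⟨c, hc, hc0⟩ := PR_rolle_up n x y hxy hx hy
        have h1 := hmin x hx
        have h2 := hmax y hy
        refine ⟨c, ?_, hc.1, hc.2⟩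
        rw [Finset.mem_erase, Finset.mem_erase, mem_PR]
        exact ⟨by rintro rfl; linarith [hc.1], by rintro rfl; linarith [hc.2], hc0⟩
      have hb1 : b ∈ (PR (n + 1)).roots.toFinset := (mem_PR _ _).2 hb0
      have hb2 : -b ∈ (PR (n + 1)).roots.toFinset.erase b :=
        Finset.mem_erase.2 ⟨by intro h; linarith, (mem_PR _ _).2 (PR_neg_root _ _ hb0)⟩
      have c1 := Finset.card_erase_add_one hb1
      have c2 := Finset.card_erase_add_one hb2
      omega

lemma R_natDegree_le (n : ℕ) : (R n).natDegree ≤ n := by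
  unfold R
  apply natDegree_sum_le_of_forall_le
  intro k _
  exact (natDegree_C_mul_X_pow_le _ _).trans (Nat.sub_le _ _)

lemma Rc_natDegree_le (n : ℕ) : (Rc n).natDegree ≤ n :=
  natDegree_map_le.trans (R_natDegree_le n)

lemma Rc_ne_zero (n : ℕ) : Rc n ≠ 0 := by
  intro h
  apply PR_ne_zero n
  apply Polynomial.funext
  intro x
  rw [eval_zero, ← Rc_root_iff, h]
  simp

lemma Rc_roots (n : ℕ) : (Rc n).roots.toFinset.card = n ∧
    (Rc n).roots.toFinset = (PR n).roots.toFinset.image (fun x : ℝ => Complex.I * (x : ℂ)) := by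
  have hinj : Function.Injective (fun x : ℝ => Complex.I * (x : ℂ)) := by
    intro x y h
    simpa using h
  have hle : (Rc n).roots.toFinset.card ≤ n :=
    (Multiset.toFinset_card_le _).trans ((card_roots' _).trans (Rc_natDegree_le n))
  have hsub : (PR n).roots.toFinset.image (fun x : ℝ => Complex.I * (x : ℂ))
      ⊆ (Rc n).roots.toFinset := by
    intro z hz
    obtain ⟨x, hx, rfl⟩ := Finset.mem_image.1 hz
    rw [mem_PR, ← Rc_root_iff] at hx
    rw [Multiset.mem_toFinset, mem_roots (Rc_ne_zero n)]
    exact hx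
  have hc := Finset.card_image_of_injective (PR n).roots.toFinset hinj
  have h1 := PR_card n
  have h2 := Finset.card_le_card hsub
  exact ⟨by omega, (Finset.eq_of_subset_of_card_le hsub (by omega)).symm⟩

lemma Rc_root_im (n : ℕ) (z : ℂ) (hz : (Rc n).IsRoot z) :
    ∃ x : ℝ, (PR n).eval x = 0 ∧ z = Complex.I * (x : ℂ) := by
  have : z ∈ (Rc n).roots.toFinset := by
    rw [Multiset.mem_toFinset, mem_roots (Rc_ne_zero n)]; exact hz
  rw [(Rc_roots n).2] at this
  obtain ⟨x, hx, rfl⟩ := Finset.mem_image.1 this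
  exact ⟨x, (mem_PR _ _).1 hx, rfl⟩

/-- For `n ≥ 1`, `R_n` over `ℂ` has exactly `n` distinct roots (so all roots are simple);
every root is purely imaginary; the set of roots is invariant under negation; and for
`n ≥ 2` the roots of `R_{n−1}` interlace those of `R_n`: exactly one root of `R_{n−1}`
lies in each open interval between consecutive values of `β`, where the roots of `R_n`
are written as `iβ` with `β` real. -/
theorem stmt4 (n : ℕ) (hn : 1 ≤ n) :
    (Rc n).roots.toFinset.card = n ∧
    (∀ z ∈ (Rc n).roots, z.re = 0) ∧
    (∀ z : ℂ, (Rc n).IsRoot z → (Rc n).IsRoot (-z)) ∧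
    (2 ≤ n → ∀ β₁ β₂ : ℝ, β₁ < β₂ →
      (Rc n).IsRoot (Complex.I * (β₁ : ℂ)) → (Rc n).IsRoot (Complex.I * (β₂ : ℂ)) →
      (∀ β ∈ Set.Ioo β₁ β₂, ¬ (Rc n).IsRoot (Complex.I * (β : ℂ))) →
      ∃! γ : ℝ, γ ∈ Set.Ioo β₁ β₂ ∧ (Rc (n - 1)).IsRoot (Complex.I * (γ : ℂ))) := by
  refine ⟨(Rc_roots n).1, ?_, ?_, ?_⟩
  · intro z hz
    obtain ⟨x, _, rfl⟩ := Rc_root_im n z (isRoot_of_mem_roots hz)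
    simp
  · intro z hz
    obtain ⟨x, hx, rfl⟩ := Rc_root_im n z hz
    have h := (Rc_root_iff n (-x)).2 (PR_neg_root n x hx)
    simpa using h
  · intro h2 a b hab ha hb hno
    obtain ⟨m, rfl⟩ : ∃ m, n = m + 1 := ⟨n - 1, by omega⟩
    rw [Nat.add_sub_cancel]
    simp only [Rc_root_iff] at *
    obtain ⟨c, hc, hc0⟩ := PR_rolle_down m a b hab ha hb
    have key : ∀ x y, x ∈ Set.Ioo a b → y ∈ Set.Ioo a b → (PR m).eval x = 0 →
        (PR m).eval y = 0 → ¬ x < y := by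
      intro x y hx hy hx0 hy0 hxy
      obtain ⟨d, hd, hd0⟩ := PR_rolle_up m x y hxy hx0 hy0
      exact hno d ⟨hx.1.trans hd.1, hd.2.trans hy.2⟩ hd0
    refine ⟨c, ⟨hc, hc0⟩, ?_⟩
    rintro y ⟨hy, hy0⟩
    exact le_antisymm (not_lt.1 (key c y hc hy hc0 hy0)) (not_lt.1 (key y c hy hc hy0 hc0))
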